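/- Let p and r be real numbers with p ≠ 0 and r > 0, and let g(x,y,p,r) be the polynomial defined in the context. Then the point S1 = (0, p + r^2/(4*p)) lies on the variety V(g) and is a critical point of g as a function of (x,y): g(0, p + r^2/(4*p), p, r) = 0, (∂g/∂x)(0, p + r^2/(4*p), p, r) = 0, and (∂g/∂y)(0, p + r^2/(4*p), p, r) = 0, where the partial derivatives are taken with respect to x and y with p and r held fixed. -/

import Mathlib

/-- The degree-six polynomial defining the parallel lines to the parabola 4*p*y = x^2
at offset r. -/
noncomputable def gPar (x y p r : ℝ) : ℝ :=
  -2*p*r^2*y*x^2 + 8*p*r^2*y^3 + 8*p^2*r^2*y^2 - 32*y*p^3*r^2 + 16*p^4*r^2 - 16*y^4*p^2 +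
    32*y^3*p^3 - 16*p^4*y^2 + 3*r^2*x^4 + 8*p^2*r^4 + 20*p^2*r^2*x^2 - y^2*x^4 + 10*y*p*x^4 -
    x^6 - x^4*p^2 + 8*p*y^3*x^2 - 32*x^2*y^2*p^2 + 8*x^2*y*p^3 - 3*r^4*x^2 + 2*r^2*x^2*y^2 +
    r^6 - r^4*y^2 - 8*p*r^4*y

theorem parabola_singular_point_S1 (p r : ℝ) (hp : p ≠ 0) (hr : 0 < r) :
    gPar 0 (p + r^2/(4*p)) p r = 0 ∧
    deriv (fun x : ℝ => gPar x (p + r^2/(4*p)) p r) 0 = 0 ∧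
    deriv (fun y : ℝ => gPar 0 y p r) (p + r^2/(4*p)) = 0 := by
  have key : ∀ y : ℝ, gPar 0 y p r = (r^2 - y^2) * (4*p*y - 4*p^2 - r^2)^2 := by
    intro y
    unfold gPar
    ring
  have hz : 4*p*(p + r^2/(4*p)) - 4*p^2 - r^2 = 0 := by
    field_simp
    ring
  refine ⟨?_, ?_, ?_⟩
  · rw [key, hz]
    ring
  · generalize p + r^2/(4*p) = y
    have h : (fun x : ℝ => gPar x y p r) = fun x : ℝ => gPar 0 y p r + x^2 *
        (-2*p*r^2*y + 3*r^2*x^2 + 20*p^2*r^2 - y^2*x^2 + 10*y*p*x^2 - x^4 - x^2*p^2 + 8*p*y^3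
          - 32*y^2*p^2 + 8*y*p^3 - 3*r^4 + 2*r^2*y^2) := by
      funext x
      unfold gPar
      ring
    rw [h, deriv_const_add, deriv_fun_mul (by fun_prop) (by fun_prop)]
    simp
  · simp only [key]
    rw [deriv_fun_mul (by fun_prop) (by fun_prop), deriv_fun_pow (by fun_prop), hz]
    simp
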